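/- arXiv:2007.00628 — 15 statements merged into one kernel-verified Lean document; each statement's English description precedes it below -/
import Mathlib

section
/- Partition Sets (Proposition 5): Assume the combined consistency/exclusion hypothesis: for every z ∈ Z and ω ∈ Ω, Yz(z)(ω) = Yc(A(z)(ω))(ω). Fix z1 ∈ Z, a1 ∈ 𝒜 and y ∈ 𝒴. Define the sets S∅ = {ω : Yc(a1)(ω) = y and for all z ∈ Z, A(z)(ω) ≠ a1}, S1 = {ω : A(z1)(ω) = a1 and Yz(z1)(ω) = y}, and, for each a ∈ 𝒜 with a ≠ a1, Sa = {ω : A(z1)(ω) = a and there exists z ∈ Z with A(z)(ω) = a1 and Yz(z)(ω) = y}. Then S∅, S1 and the sets Sa (a ≠ a1) are pairwise disjoint and their union equals {ω : Yc(a1)(ω) = y}. -/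
/-- Partition Sets (Proposition 5). -/
theorem partition_sets {Ω Z 𝒜 𝒴 : Type*}
    (A : Z → Ω → 𝒜) (Yz : Z → Ω → 𝒴) (Yc : 𝒜 → Ω → 𝒴)
    (hcons : ∀ (z : Z) (ω : Ω), Yz z ω = Yc (A z ω) ω)
    (z1 : Z) (a1 : 𝒜) (y : 𝒴)
    (S0 : Set Ω) (hS0 : S0 = {ω | Yc a1 ω = y ∧ ∀ z : Z, A z ω ≠ a1})
    (S1 : Set Ω) (hS1 : S1 = {ω | A z1 ω = a1 ∧ Yz z1 ω = y})
    (Sa : 𝒜 → Set Ω)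
    (hSa : ∀ a : 𝒜, Sa a = {ω | A z1 ω = a ∧ ∃ z : Z, A z ω = a1 ∧ Yz z ω = y}) :
    (Disjoint S0 S1 ∧
      (∀ a : 𝒜, a ≠ a1 → Disjoint S0 (Sa a)) ∧
      (∀ a : 𝒜, a ≠ a1 → Disjoint S1 (Sa a)) ∧
      (∀ a a' : 𝒜, a ≠ a1 → a' ≠ a1 → a ≠ a' → Disjoint (Sa a) (Sa a'))) ∧
    S0 ∪ S1 ∪ (⋃ a ∈ {a : 𝒜 | a ≠ a1}, Sa a) = {ω | Yc a1 ω = y} := by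
  subst hS0 hS1
  simp only [hSa, Set.disjoint_left, Set.mem_setOf_eq]
  refine ⟨⟨?_, ?_, ?_, ?_⟩, ?_⟩
  · rintro ω ⟨_, h⟩ ⟨h', _⟩
    exact h z1 h'
  · rintro a _ ω ⟨_, h⟩ ⟨_, z, h', _⟩
    exact h z h'
  · rintro a ha ω ⟨h, _⟩ ⟨h', _⟩
    exact ha (h'.symm.trans h)
  · rintro a a' _ _ hne ω ⟨h, _⟩ ⟨h', _⟩
    exact hne (h.symm.trans h')
  · ext ω
    simp only [Set.mem_union, Set.mem_iUnion, Set.mem_setOf_eq, exists_prop]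
    constructor
    · rintro ((⟨h, _⟩ | ⟨h, h'⟩) | ⟨a, _, _, z, h, h'⟩)
      · exact h
      · rw [hcons, h] at h'
        exact h'
      · rw [hcons, h] at h'
        exact h'
    · intro hy
      by_cases h1 : A z1 ω = a1
      · exact Or.inl (Or.inr ⟨h1, by rw [hcons, h1]; exact hy⟩)
      · by_cases h : ∃ z, A z ω = a1
        · obtain ⟨z, hz⟩ := h
          exact Or.inr ⟨A z1 ω, h1, rfl, z, hz, by rw [hcons, hz]; exact hy⟩
        · exact Or.inl (Or.inl ⟨hy, fun z hz => h ⟨z, hz⟩⟩)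
end

section
/- Main aggregated lower bound (correctness of Algorithm 1): Assume 𝒜 is finite and the combined consistency/exclusion hypothesis holds: for every z ∈ Z and ω ∈ Ω, Y(z)(ω) = Yc(A(z)(ω))(ω). Fix z1 ∈ Z, a1 ∈ 𝒜 and y ∈ 𝒴. For each a ∈ 𝒜 with a ≠ a1, let z_a ∈ Z, let E_a be a measurable event with E_a ⊆ {ω : A(z1)(ω)=a}, and let Ψ_a be a measurable event with E_a ⊆ Ψ_a. Then μ({ω : Yc(a1)(ω)=y}) ≥ μ({ω : A(z1)(ω)=a1 and Y(z1)(ω)=y}) + Σ_{a ∈ 𝒜, a ≠ a1} max(0, μ(E_a) − μ(Ψ_a ∩ {ω : not (A(z_a)(ω)=a1 and Y(z_a)(ω)=y)})). -/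
open MeasureTheory

/-- Main aggregated lower bound (correctness of Algorithm 1). -/
theorem aggregated_lower_bound {Ω Z 𝒜 𝒴 : Type*} [MeasurableSpace Ω]
    [Fintype 𝒜] [DecidableEq 𝒜]
    (μ : Measure Ω) [IsProbabilityMeasure μ]
    (A : Z → Ω → 𝒜) (Y : Z → Ω → 𝒴) (Yc : 𝒜 → Ω → 𝒴)
    (hcons : ∀ (z : Z) (ω : Ω), Y z ω = Yc (A z ω) ω)
    (hAm : ∀ (z : Z) (a : 𝒜), MeasurableSet {ω | A z ω = a})
    (hYm : ∀ (z : Z) (y' : 𝒴), MeasurableSet {ω | Y z ω = y'})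
    (hYcm : ∀ (a : 𝒜) (y' : 𝒴), MeasurableSet {ω | Yc a ω = y'})
    (z1 : Z) (a1 : 𝒜) (y : 𝒴)
    (za : 𝒜 → Z) (E : 𝒜 → Set Ω) (Ψ : 𝒜 → Set Ω)
    (hEm : ∀ a, MeasurableSet (E a)) (hΨm : ∀ a, MeasurableSet (Ψ a))
    (hE : ∀ a : 𝒜, a ≠ a1 → E a ⊆ {ω | A z1 ω = a})
    (hEΨ : ∀ a : 𝒜, a ≠ a1 → E a ⊆ Ψ a) :
    (μ {ω | A z1 ω = a1 ∧ Y z1 ω = y}).toReal +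
      ∑ a ∈ Finset.univ.filter (· ≠ a1),
        max 0 ((μ (E a)).toReal -
          (μ (Ψ a ∩ {ω | ¬ (A (za a) ω = a1 ∧ Y (za a) ω = y)})).toReal)
      ≤ (μ {ω | Yc a1 ω = y}).toReal := by
  have hsum : ∑ a : 𝒜, μ.real ({ω | Yc a1 ω = y} ∩ {ω | A z1 ω = a})
      = μ.real {ω | Yc a1 ω = y} := by
    rw [← measureReal_biUnion_finset]
    · congr 1
      ext ω
      simp
    · intro a _ b _ hab
      refine Set.disjoint_left.mpr ?_
      rintro ω ⟨_, h1⟩ ⟨_, h2⟩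
      exact hab (h1.symm.trans h2)
    · intro a _
      exact (hYcm a1 y).inter (hAm z1 a)
  change μ.real _ + _ ≤ μ.real _
  rw [← hsum, ← Finset.add_sum_erase _ _ (Finset.mem_univ a1)]
  refine add_le_add ?_ ?_
  · refine measureReal_mono ?_
    rintro ω ⟨h1, h2⟩
    refine ⟨?_, h1⟩
    have := hcons z1 ω
    rw [h1, h2] at this
    exact this.symm
  · have hf : Finset.univ.filter (· ≠ a1) = Finset.univ.erase a1 := by
      ext a
      simp
    rw [hf]
    refine Finset.sum_le_sum fun a ha => ?_
    have hne : a ≠ a1 := (Finset.mem_erase.mp ha).1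
    refine max_le measureReal_nonneg ?_
    rw [sub_le_iff_le_add]
    change μ.real _ ≤ _ + μ.real _
    refine le_trans (measureReal_mono ?_) (measureReal_union_le _ _)
    intro ω hω
    by_cases h : A (za a) ω = a1 ∧ Y (za a) ω = y
    · left
      refine ⟨?_, hE a hne hω⟩
      have := hcons (za a) ω
      rw [h.1, h.2] at this
      exact this.symm
    · right
      exact ⟨hEΨ a hne hω, h⟩
end

section
/- Proposition 7: Let (Ω, ℱ, μ) be a probability space with μ a probability measure, let E_1, …, E_N be measurable events, and let k ∈ ℕ. Suppose that at most k of the events are mutually compatible, i.e., every index set S ⊆ {1, …, N} such that E_i ∩ E_j ≠ ∅ for all i, j ∈ S satisfies |S| ≤ k. Then Σ_{i=1}^N μ(E_i) ≤ k. -/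
open MeasureTheory

/-- Proposition 7: if at most `k` of the events are mutually compatible
(pairwise non-disjoint), the sum of their probabilities is at most `k`. -/
theorem sum_le_of_at_most_k_compatible {Ω : Type*} [MeasurableSpace Ω]
    (μ : Measure Ω) [IsProbabilityMeasure μ]
    (N k : ℕ) (E : Fin N → Set Ω) (hEm : ∀ i, MeasurableSet (E i))
    (hk : ∀ S : Finset (Fin N),
      (∀ i ∈ S, ∀ j ∈ S, (E i ∩ E j).Nonempty) → S.card ≤ k) :
    ∑ i, (μ (E i)).toReal ≤ (k : ℝ) := by
  classical
  have h1 : ∑ i, μ (E i) ≤ (k : ENNReal) := by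
    calc ∑ i, μ (E i) = ∑ i, ∫⁻ x, (E i).indicator 1 x ∂μ := by
          refine Finset.sum_congr rfl fun i _ => ?_
          rw [lintegral_indicator_one (hEm i)]
      _ = ∫⁻ x, ∑ i, (E i).indicator 1 x ∂μ := by
          rw [lintegral_finsetSum]
          exact fun i _ => measurable_one.indicator (hEm i)
      _ ≤ ∫⁻ _, (k : ENNReal) ∂μ := by
          refine lintegral_mono fun x => ?_
          have h := hk (Finset.univ.filter fun i => x ∈ E i) (by
            intro i hi j hj
            simp only [Finset.mem_filter, Finset.mem_univ, true_and] at hi hj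
            exact ⟨x, hi, hj⟩)
          simp only [Set.indicator_apply, Pi.one_apply, Finset.sum_boole]
          exact_mod_cast h
      _ = k := by simp
  rw [← ENNReal.toReal_sum (fun i _ => measure_ne_top μ (E i))]
  simpa using ENNReal.toReal_mono (ENNReal.natCast_ne_top k) h1
end

section
/- Generalized Instrumental Inequalities (Corollary to Proposition 7): Assume the combined consistency/exclusion hypothesis: for every z ∈ Z and ω ∈ Ω, Y(z)(ω) = Yc(A(z)(ω))(ω). Let S be a finite set of triples (z, a, y) ∈ Z × 𝒜 × 𝒴, and define Φ(S) as the maximum cardinality of a subset Q ⊆ S such that for all (z,a,y), (z',a',y') ∈ Q it is not the case that (z = z' and a ≠ a') or (a = a' and y ≠ y'). Then Σ_{(z,a,y) ∈ S} μ({ω : A(z)(ω)=a and Y(z)(ω)=y}) ≤ Φ(S). -/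
open MeasureTheory

/-- Generalized Instrumental Inequalities (Corollary to Proposition 7). -/
theorem generalized_instrumental_inequalities
    {Ω Z 𝒜 𝒴 : Type*} [MeasurableSpace Ω]
    [DecidableEq Z] [DecidableEq 𝒜] [DecidableEq 𝒴]
    (μ : Measure Ω) [IsProbabilityMeasure μ]
    (A : Z → Ω → 𝒜) (Y : Z → Ω → 𝒴) (Yc : 𝒜 → Ω → 𝒴)
    (hcons : ∀ (z : Z) (ω : Ω), Y z ω = Yc (A z ω) ω)
    (hAm : ∀ (z : Z) (a : 𝒜), MeasurableSet {ω | A z ω = a})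
    (hYm : ∀ (z : Z) (y : 𝒴), MeasurableSet {ω | Y z ω = y})
    (S : Finset (Z × 𝒜 × 𝒴)) :
    ∑ t ∈ S, (μ {ω | A t.1 ω = t.2.1 ∧ Y t.1 ω = t.2.2}).toReal ≤
      ((S.powerset.filter (fun Q => ∀ t ∈ Q, ∀ t' ∈ Q,
          ¬ ((t.1 = t'.1 ∧ t.2.1 ≠ t'.2.1) ∨
             (t.2.1 = t'.2.1 ∧ t.2.2 ≠ t'.2.2)))).sup Finset.card : ℕ) := by
  classical
  have hm : ∀ t : Z × 𝒜 × 𝒴, MeasurableSet {ω | A t.1 ω = t.2.1 ∧ Y t.1 ω = t.2.2} :=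
    fun t => (hAm t.1 t.2.1).inter (hYm t.1 t.2.2)
  have hi : ∀ t ∈ S, Integrable
      (({ω | A t.1 ω = t.2.1 ∧ Y t.1 ω = t.2.2}).indicator (fun _ => (1 : ℝ))) μ :=
    fun t _ => (integrable_const (1 : ℝ)).indicator (hm t)
  have h1 : ∀ t ∈ S, (μ {ω | A t.1 ω = t.2.1 ∧ Y t.1 ω = t.2.2}).toReal =
      ∫ ω, ({ω | A t.1 ω = t.2.1 ∧ Y t.1 ω = t.2.2}).indicator (fun _ => (1 : ℝ)) ω ∂μ := by
    intro t _
    rw [integral_indicator_const _ (hm t)]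
    simp [Measure.real]
  rw [Finset.sum_congr rfl h1, ← integral_finsetSum S hi]
  refine (integral_mono (integrable_finsetSum S hi) (integrable_const _) ?_).trans
    (le_of_eq (by rw [integral_const]; simp only [probReal_univ, one_smul]; rfl))
  intro ω
  have h2 : ∑ t ∈ S, ({ω | A t.1 ω = t.2.1 ∧ Y t.1 ω = t.2.2}).indicator (fun _ => (1 : ℝ)) ω
      = ((S.filter (fun t => A t.1 ω = t.2.1 ∧ Y t.1 ω = t.2.2)).card : ℝ) := by
    simp [Set.indicator_apply, Finset.sum_boole]
  dsimp only
  rw [h2, Nat.cast_le]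
  apply Finset.le_sup (f := Finset.card)
  rw [Finset.mem_filter]
  refine ⟨Finset.mem_powerset.2 (Finset.filter_subset _ _), ?_⟩
  intro t ht t' ht'
  obtain ⟨-, ha, hy⟩ := Finset.mem_filter.1 ht
  obtain ⟨-, ha', hy'⟩ := Finset.mem_filter.1 ht'
  rintro (⟨h, h'⟩ | ⟨h, h'⟩)
  · exact h' (by rw [← ha, ← ha', h])
  · exact h' (by rw [← hy, ← hy', hcons, hcons, ha, ha', h])
end

section
/- Instrumental variable inequalities (special case of the Generalized Instrumental Inequalities with k = 1): Assume 𝒴 is finite, Z is finite and nonempty, and the combined consistency/exclusion hypothesis holds: for every z ∈ Z and ω ∈ Ω, Y(z)(ω) = Yc(A(z)(ω))(ω). Then for every a ∈ 𝒜, Σ_{y ∈ 𝒴} max_{z ∈ Z} μ({ω : A(z)(ω)=a and Y(z)(ω)=y}) ≤ 1. -/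
open MeasureTheory

/-- The instrumental variable inequalities
(special case of the Generalized Instrumental Inequalities with k = 1). -/
theorem iv_inequalities {Ω Z 𝒜 𝒴 : Type*} [MeasurableSpace Ω]
    [Fintype Z] [Nonempty Z] [Fintype 𝒴]
    (μ : Measure Ω) [IsProbabilityMeasure μ]
    (A : Z → Ω → 𝒜) (Y : Z → Ω → 𝒴) (Yc : 𝒜 → Ω → 𝒴)
    (hcons : ∀ (z : Z) (ω : Ω), Y z ω = Yc (A z ω) ω)
    (hAm : ∀ (z : Z) (a : 𝒜), MeasurableSet {ω | A z ω = a})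
    (hYm : ∀ (z : Z) (y : 𝒴), MeasurableSet {ω | Y z ω = y}) :
    ∀ a : 𝒜,
      ∑ y : 𝒴, (Finset.univ.sup' Finset.univ_nonempty
        fun z : Z => (μ {ω | A z ω = a ∧ Y z ω = y}).toReal) ≤ 1 := by
  intro a
  have h : ∀ y : 𝒴, ∃ z : Z, (Finset.univ.sup' Finset.univ_nonempty
        fun z : Z => (μ {ω | A z ω = a ∧ Y z ω = y}).toReal)
        = μ.real {ω | A z ω = a ∧ Y z ω = y} := by
    intro y
    obtain ⟨z, _, hz⟩ := Finset.exists_mem_eq_sup' (Finset.univ_nonempty (α := Z))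
      (fun z : Z => (μ {ω | A z ω = a ∧ Y z ω = y}).toReal)
    exact ⟨z, hz⟩
  choose f hf using h
  rw [Finset.sum_congr rfl (fun y _ => hf y)]
  have hm : ∀ y, MeasurableSet {ω | A (f y) ω = a ∧ Y (f y) ω = y} :=
    fun y => (hAm (f y) a).inter (hYm (f y) y)
  have hd : Pairwise (Function.onFun Disjoint
      (fun y => {ω | A (f y) ω = a ∧ Y (f y) ω = y})) := by
    intro y y' hne
    refine Set.disjoint_left.mpr ?_
    rintro ω ⟨h1, h2⟩ ⟨h3, h4⟩
    rw [hcons, h1] at h2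
    rw [hcons, h3] at h4
    exact hne (h2.symm.trans h4)
  rw [← measureReal_iUnion_fintype hd hm]
  exact measureReal_le_one
end

section
/- Bonet's inequality (recovered as a special case of the Generalized Instrumental Inequalities): Assume the combined consistency/exclusion hypothesis: for every z ∈ Z and ω ∈ Ω, Y(z)(ω) = Yc(A(z)(ω))(ω). Let z1, z2, z3 ∈ Z be pairwise distinct, a1 ≠ a2 in 𝒜 and y1 ≠ y2 in 𝒴. Then μ({A(z2)=a1 and Y(z2)=y2}) + μ({A(z3)=a1 and Y(z3)=y1}) + μ({A(z1)=a1 and Y(z1)=y2}) + μ({A(z2)=a2 and Y(z2)=y2}) + μ({A(z1)=a2 and Y(z1)=y1}) ≤ 2. -/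
open MeasureTheory

theorem five_aux {p1 p2 p3 p4 p5 : Prop} [Decidable p1] [Decidable p2] [Decidable p3]
    [Decidable p4] [Decidable p5] (n12 : ¬ (p1 ∧ p2)) (n14 : ¬ (p1 ∧ p4)) (n23 : ¬ (p2 ∧ p3))
    (n35 : ¬ (p3 ∧ p5)) (n45 : ¬ (p4 ∧ p5)) :
    (if p1 then (1:ℝ) else 0) + (if p2 then (1:ℝ) else 0) + (if p3 then (1:ℝ) else 0) +
      (if p4 then (1:ℝ) else 0) + (if p5 then (1:ℝ) else 0) ≤ 2 := by
  split_ifs <;> first | (exfalso; tauto) | norm_num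

/-- Bonet's inequality, recovered as a special case of the
Generalized Instrumental Inequalities. -/
theorem bonet_inequality {Ω Z 𝒜 𝒴 : Type*} [MeasurableSpace Ω]
    (μ : Measure Ω) [IsProbabilityMeasure μ]
    (A : Z → Ω → 𝒜) (Y : Z → Ω → 𝒴) (Yc : 𝒜 → Ω → 𝒴)
    (hcons : ∀ (z : Z) (ω : Ω), Y z ω = Yc (A z ω) ω)
    (hAm : ∀ (z : Z) (a : 𝒜), MeasurableSet {ω | A z ω = a})
    (hYm : ∀ (z : Z) (y : 𝒴), MeasurableSet {ω | Y z ω = y})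
    (z1 z2 z3 : Z) (hz12 : z1 ≠ z2) (hz13 : z1 ≠ z3) (hz23 : z2 ≠ z3)
    (a1 a2 : 𝒜) (ha : a1 ≠ a2) (y1 y2 : 𝒴) (hy : y1 ≠ y2) :
    (μ {ω | A z2 ω = a1 ∧ Y z2 ω = y2}).toReal +
    (μ {ω | A z3 ω = a1 ∧ Y z3 ω = y1}).toReal +
    (μ {ω | A z1 ω = a1 ∧ Y z1 ω = y2}).toReal +
    (μ {ω | A z2 ω = a2 ∧ Y z2 ω = y2}).toReal +
    (μ {ω | A z1 ω = a2 ∧ Y z1 ω = y1}).toReal ≤ 2 := by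
  classical
  have hm : ∀ z a y, MeasurableSet {ω | A z ω = a ∧ Y z ω = y} :=
    fun z a y => (hAm z a).inter (hYm z y)
  have hint : ∀ z a y, Integrable ({ω | A z ω = a ∧ Y z ω = y}.indicator (fun _ => (1:ℝ))) μ :=
    fun z a y => (integrable_const (1:ℝ)).indicator (hm z a y)
  have hval : ∀ z a y, (μ {ω | A z ω = a ∧ Y z ω = y}).toReal =
      ∫ ω, {ω | A z ω = a ∧ Y z ω = y}.indicator (fun _ => (1:ℝ)) ω ∂μ := by
    intro z a y
    rw [integral_indicator (hm z a y)]
    simp [Measure.real]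
  simp only [hval]
  have h1 := (hint z2 a1 y2).add (hint z3 a1 y1)
  have h2 := h1.add (hint z1 a1 y2)
  have h3 := h2.add (hint z2 a2 y2)
  have h4 := h3.add (hint z1 a2 y1)
  rw [← integral_add' (hint z2 a1 y2) (hint z3 a1 y1), ← integral_add' h1 (hint z1 a1 y2),
    ← integral_add' h2 (hint z2 a2 y2), ← integral_add' h3 (hint z1 a2 y1)]
  have h5 := integral_mono (μ := μ) h4 (integrable_const (2:ℝ)) (by
    intro ω
    have c1 := hcons z1 ω
    have c2 := hcons z2 ω
    have c3 := hcons z3 ω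
    simp only [Pi.add_apply, Set.indicator_apply, Set.mem_ofPred_eq]
    have n12 : ¬ ((A z2 ω = a1 ∧ Y z2 ω = y2) ∧ (A z3 ω = a1 ∧ Y z3 ω = y1)) := by grind
    have n14 : ¬ ((A z2 ω = a1 ∧ Y z2 ω = y2) ∧ (A z2 ω = a2 ∧ Y z2 ω = y2)) := by grind
    have n23 : ¬ ((A z3 ω = a1 ∧ Y z3 ω = y1) ∧ (A z1 ω = a1 ∧ Y z1 ω = y2)) := by grind
    have n35 : ¬ ((A z1 ω = a1 ∧ Y z1 ω = y2) ∧ (A z1 ω = a2 ∧ Y z1 ω = y1)) := by grind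
    have n45 : ¬ ((A z2 ω = a2 ∧ Y z2 ω = y2) ∧ (A z1 ω = a2 ∧ Y z1 ω = y1)) := by grind
    exact five_aux n12 n14 n23 n35 n45)
  refine h5.trans ?_
  simp
end

section
/- Sharp lower bound in the binary IV model (Balke–Pearl lower bound, Section 3): Assume Z = 𝒜 = 𝒴 = Bool and the combined consistency/exclusion hypothesis: for every z and ω, Y(z)(ω) = Yc(A(z)(ω))(ω). For z', a', y' ∈ Bool write P_{z'}(a', y') := μ({ω : A(z')(ω)=a' and Y(z')(ω)=y'}). Then for all z, a, y ∈ Bool, writing z̄ = ¬z, ā = ¬a, ȳ = ¬y: μ({ω : Yc(a)(ω)=y}) ≥ P_{z̄}(a, y) + max{ 0, P_{z̄}(ā, ȳ) − P_z(ā, ȳ) − P_z(a, ȳ), P_{z̄}(ā, y) − P_z(ā, y) − P_z(a, ȳ), P_z(a, y) − P_{z̄}(a, y) }. -/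
open MeasureTheory

lemma bp_aux {Ω : Type*} [MeasurableSpace Ω] (μ : Measure Ω) [IsProbabilityMeasure μ]
    (B C T D E : Set Ω) (hC : MeasurableSet C) (hd : Disjoint B C)
    (h : B ∪ C ⊆ T ∪ D ∪ E) :
    μ.real B + μ.real C ≤ μ.real T + μ.real D + μ.real E := by
  rw [← measureReal_union hd hC]
  have h1 := measureReal_mono (μ := μ) h
  have h2 := measureReal_union_le (μ := μ) (T ∪ D) E
  have h3 := measureReal_union_le (μ := μ) T D
  linarith

/-- Sharp lower bound in the binary IV model (Balke–Pearl lower bound). -/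
theorem balke_pearl_lower_bound {Ω : Type*} [MeasurableSpace Ω]
    (μ : Measure Ω) [IsProbabilityMeasure μ]
    (A : Bool → Ω → Bool) (Yc : Bool → Ω → Bool) (Y : Bool → Ω → Bool)
    (hY : ∀ (z : Bool) (ω : Ω), Y z ω = Yc (A z ω) ω)
    (hAm : ∀ z : Bool, Measurable (A z))
    (hYcm : ∀ a : Bool, Measurable (Yc a))
    (hYm : ∀ z : Bool, Measurable (Y z)) :
    ∀ z a y : Bool,
      (μ {ω | A (!z) ω = a ∧ Y (!z) ω = y}).toReal +
        max (max (max 0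
          ((μ {ω | A (!z) ω = !a ∧ Y (!z) ω = !y}).toReal -
            (μ {ω | A z ω = !a ∧ Y z ω = !y}).toReal -
            (μ {ω | A z ω = a ∧ Y z ω = !y}).toReal))
          ((μ {ω | A (!z) ω = !a ∧ Y (!z) ω = y}).toReal -
            (μ {ω | A z ω = !a ∧ Y z ω = y}).toReal -
            (μ {ω | A z ω = a ∧ Y z ω = !y}).toReal))
          ((μ {ω | A z ω = a ∧ Y z ω = y}).toReal -
            (μ {ω | A (!z) ω = a ∧ Y (!z) ω = y}).toReal)
      ≤ (μ {ω | Yc a ω = y}).toReal := by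
  intro z a y
  have hm : ∀ z a y : Bool, MeasurableSet {ω | A z ω = a ∧ Y z ω = y} := fun z a y =>
    (hAm z (measurableSet_singleton a)).inter (hYm z (measurableSet_singleton y))
  have hsub : ∀ z : Bool, {ω | A z ω = a ∧ Y z ω = y} ⊆ {ω | Yc a ω = y} := by
    rintro z ω ⟨h1, h2⟩
    rw [hY, h1] at h2
    exact h2
  have hT : ∀ z : Bool, μ.real {ω | A z ω = a ∧ Y z ω = y} ≤ μ.real {ω | Yc a ω = y} :=
    fun z => measureReal_mono (hsub z)
  have key : ∀ y' : Bool, μ.real {ω | A (!z) ω = a ∧ Y (!z) ω = y}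
      + μ.real {ω | A (!z) ω = !a ∧ Y (!z) ω = y'}
      ≤ μ.real {ω | Yc a ω = y} + μ.real {ω | A z ω = !a ∧ Y z ω = y'}
      + μ.real {ω | A z ω = a ∧ Y z ω = !y} := by
    intro y'
    refine bp_aux μ _ _ _ _ _ (hm _ _ _) ?_ ?_
    · rw [Set.disjoint_left]
      rintro ω ⟨h1, -⟩ ⟨h2, -⟩
      rw [h1] at h2
      cases a <;> simp at h2
    · rintro ω (h | ⟨h1, h2⟩)
      · exact Or.inl (Or.inl (hsub _ h))
      · rw [hY, h1] at h2
        by_cases h3 : A z ω = a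
        · by_cases h4 : Yc a ω = y
          · exact Or.inl (Or.inl h4)
          · refine Or.inr ⟨h3, ?_⟩
            rw [hY, h3]
            exact Bool.eq_not_of_ne h4
        · have h5 : A z ω = !a := Bool.eq_not_of_ne h3
          refine Or.inl (Or.inr ⟨h5, ?_⟩)
          rw [hY, h5]
          exact h2
  have k1 := key (!y)
  have k2 := key y
  have t1 := hT z
  have t2 := hT (!z)
  simp only [Measure.real] at k1 k2 t1 t2
  rw [← le_sub_iff_add_le']
  refine max_le (max_le (max_le ?_ ?_) ?_) ?_ <;> linarith
end

section
/- Upper bound in the binary IV model (complement of the sharp lower bound): Assume Z = 𝒜 = 𝒴 = Bool and the combined consistency/exclusion hypothesis: for every z and ω, Y(z)(ω) = Yc(A(z)(ω))(ω). For z', a', y' ∈ Bool write P_{z'}(a', y') := μ({ω : A(z')(ω)=a' and Y(z')(ω)=y'}). Then for all z, a, y ∈ Bool, writing z̄ = ¬z, ā = ¬a, ȳ = ¬y: μ({ω : Yc(a)(ω)=y}) ≤ 1 − P_{z̄}(a, ȳ) − max{ 0, P_{z̄}(ā, y) − P_z(ā, y) − P_z(a, y), P_{z̄}(ā, ȳ)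 − P_z(ā, ȳ) − P_z(a, y), P_z(a, ȳ) − P_{z̄}(a, ȳ) }. -/
open MeasureTheory

theorem bp_aux_s10 {Ω : Type*} [MeasurableSpace Ω]
    (μ : Measure Ω) [IsProbabilityMeasure μ] (S T U V W : Set Ω)
    (hT : MeasurableSet T) (hU : MeasurableSet U)
    (h1 : ∀ ω, ω ∈ S → ω ∉ T) (h2 : ∀ ω, ω ∈ U → ω ∉ T)
    (h3 : ∀ ω, ω ∈ S → ω ∈ U → ω ∈ V ∨ ω ∈ W) :
    μ.real S + μ.real T + μ.real U ≤ 1 + μ.real V + μ.real W := by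
  have e1 := measureReal_union_add_inter (μ := μ) (s := S) (t := U) hU
  have e2 : μ.real ((S ∪ U) ∪ T) = μ.real (S ∪ U) + μ.real T := by
    apply measureReal_union _ hT
    rw [Set.disjoint_left]
    rintro ω (h | h)
    · exact h1 ω h
    · exact h2 ω h
  have e3 : μ.real ((S ∪ U) ∪ T) ≤ 1 := measureReal_le_one
  have e4 : μ.real (S ∩ U) ≤ μ.real (V ∪ W) :=
    measureReal_mono (fun ω h => h3 ω h.1 h.2)
  have e5 : μ.real (V ∪ W) ≤ μ.real V + μ.real W := measureReal_union_le V W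
  linarith

/-- Upper bound in the binary IV model (complement of the sharp lower bound). -/
theorem balke_pearl_upper_bound {Ω : Type*} [MeasurableSpace Ω]
    (μ : Measure Ω) [IsProbabilityMeasure μ]
    (A : Bool → Ω → Bool) (Yc : Bool → Ω → Bool) (Y : Bool → Ω → Bool)
    (hY : ∀ (z : Bool) (ω : Ω), Y z ω = Yc (A z ω) ω)
    (hAm : ∀ z : Bool, Measurable (A z))
    (hYcm : ∀ a : Bool, Measurable (Yc a))
    (hYm : ∀ z : Bool, Measurable (Y z)) :
    ∀ z a y : Bool,
      (μ {ω | Yc a ω = y}).toReal ≤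
        1 - (μ {ω | A (!z) ω = a ∧ Y (!z) ω = !y}).toReal -
        max (max (max 0
          ((μ {ω | A (!z) ω = !a ∧ Y (!z) ω = y}).toReal -
            (μ {ω | A z ω = !a ∧ Y z ω = y}).toReal -
            (μ {ω | A z ω = a ∧ Y z ω = y}).toReal))
          ((μ {ω | A (!z) ω = !a ∧ Y (!z) ω = !y}).toReal -
            (μ {ω | A z ω = !a ∧ Y z ω = !y}).toReal -
            (μ {ω | A z ω = a ∧ Y z ω = y}).toReal))
          ((μ {ω | A z ω = a ∧ Y z ω = !y}).toReal -
            (μ {ω | A (!z) ω = a ∧ Y (!z) ω = !y}).toReal) := by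
  intro z a y
  have hm : ∀ z' a' y' : Bool, MeasurableSet {ω | A z' ω = a' ∧ Y z' ω = y'} := by
    intro z' a' y'
    exact (hAm z' (measurableSet_singleton a')).inter (hYm z' (measurableSet_singleton y'))
  simp only [← measureReal_def]
  have c1 := bp_aux_s10 μ {ω | Yc a ω = y} {ω | A (!z) ω = a ∧ Y (!z) ω = !y} ∅ ∅ ∅
    (hm _ _ _) MeasurableSet.empty (by grind) (by simp) (by simp)
  have c2 := bp_aux_s10 μ {ω | Yc a ω = y} {ω | A (!z) ω = a ∧ Y (!z) ω = !y}
    {ω | A (!z) ω = !a ∧ Y (!z) ω = y} {ω | A z ω = !a ∧ Y z ω = y}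
    {ω | A z ω = a ∧ Y z ω = y}
    (hm _ _ _) (hm _ _ _) (by grind) (by grind) (by
      intro ω h1 h2
      simp only [Set.mem_setOf_eq, hY] at h1 h2 ⊢
      obtain ⟨h2, h3⟩ := h2
      rw [h2] at h3
      rcases Bool.eq_or_eq_not (A z ω) a with h | h
      · right; rw [h]; exact ⟨rfl, h1⟩
      · left; rw [h]; exact ⟨rfl, h3⟩)
  have c3 := bp_aux_s10 μ {ω | Yc a ω = y} {ω | A (!z) ω = a ∧ Y (!z) ω = !y}
    {ω | A (!z) ω = !a ∧ Y (!z) ω = !y} {ω | A z ω = !a ∧ Y z ω = !y}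
    {ω | A z ω = a ∧ Y z ω = y}
    (hm _ _ _) (hm _ _ _) (by grind) (by grind) (by
      intro ω h1 h2
      simp only [Set.mem_setOf_eq, hY] at h1 h2 ⊢
      obtain ⟨h2, h3⟩ := h2
      rw [h2] at h3
      rcases Bool.eq_or_eq_not (A z ω) a with h | h
      · right; rw [h]; exact ⟨rfl, h1⟩
      · left; rw [h]; exact ⟨rfl, h3⟩)
  have c4 := bp_aux_s10 μ {ω | Yc a ω = y} {ω | A z ω = a ∧ Y z ω = !y} ∅ ∅ ∅
    (hm _ _ _) MeasurableSet.empty (by grind) (by simp) (by simp)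
  simp only [measureReal_empty] at c1 c4
  rw [le_sub_comm]
  refine max_le (max_le (max_le ?_ ?_) ?_) ?_ <;> linarith
end

section
/- Trivial bounds for any causal model (Corollary 'trivial bounds'): Let A : Ω → 𝒜 and Y : Ω → 𝒴 be the observed (factual) treatment and outcome, let Yc : 𝒜 → Ω → 𝒴 represent the counterfactual outcome Y(a) under intervention A=a, and assume consistency: for every ω ∈ Ω, Y(ω) = Yc(A(ω))(ω). Then for every a ∈ 𝒜 and y ∈ 𝒴, μ({ω : Y(ω)=y and A(ω)=a}) ≤ μ({ω : Yc(a)(ω)=y}) ≤ 1 − μ({ω : Y(ω)≠y and A(ω)=a}). -/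
open MeasureTheory

/-- Trivial bounds for any causal model (Corollary `trivial-bounds`). -/
theorem trivial_bounds {Ω 𝒜 𝒴 : Type*} [MeasurableSpace Ω]
    (μ : Measure Ω) [IsProbabilityMeasure μ]
    (A : Ω → 𝒜) (Y : Ω → 𝒴) (Yc : 𝒜 → Ω → 𝒴)
    (hcons : ∀ ω : Ω, Y ω = Yc (A ω) ω)
    (hAm : ∀ a : 𝒜, MeasurableSet {ω | A ω = a})
    (hYm : ∀ y : 𝒴, MeasurableSet {ω | Y ω = y})
    (hYcm : ∀ (a : 𝒜) (y : 𝒴), MeasurableSet {ω | Yc a ω = y}) :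
    ∀ (a : 𝒜) (y : 𝒴),
      (μ {ω | Y ω = y ∧ A ω = a}).toReal ≤ (μ {ω | Yc a ω = y}).toReal ∧
      (μ {ω | Yc a ω = y}).toReal ≤ 1 - (μ {ω | Y ω ≠ y ∧ A ω = a}).toReal := by
  intro a y
  refine ⟨ENNReal.toReal_mono (measure_ne_top _ _) (measure_mono ?_), ?_⟩
  · rintro ω ⟨h1, h2⟩
    have h := hcons ω
    rw [h2, h1] at h
    exact h.symm
  · have h1 : μ.real {ω | Yc a ω = y}ᶜ = 1 - μ.real {ω | Yc a ω = y} :=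
      probReal_compl_eq_one_sub (hYcm a y)
    have h2 : μ.real {ω | Y ω ≠ y ∧ A ω = a} ≤ μ.real {ω | Yc a ω = y}ᶜ := by
      refine measureReal_mono ?_
      rintro ω ⟨h3, h4⟩ h5
      have h := hcons ω
      rw [h4] at h
      exact h3 (h.trans h5)
    simp only [Measure.real] at h1 h2
    linarith
end

section
/- Corollary 'fix-subset' (bounds when a subset of the treatments acts as a generalized instrument for the remainder): Let the treatment set be partitioned into Ã (with fixed value ã) and Â. Let Â0 : Ω → ℬ represent the counterfactual Â(ã) under intervention Ã=ã, let Yt : Ω → 𝒴 represent the counterfactual outcome Y(ã) under intervention Ã=ã, and let Yf : ℬ → Ω → 𝒴 represent the counterfactual outcome Y(ã, â) under joint intervention Ã=ã, Â=â. Assume consistency: for every ω ∈ Ω, Yt(ω) = Yf(Â0(ω))(ω). Then for every â ∈ ℬ and y ∈ 𝒴, μ({ω : Yt(ω)=y and Â0(ω)=â}) ≤ μ({ω : Yf(â)(ω)=y}) ≤ 1 − μ({ω : Yt(ω)≠y and Â0(ω)=â}). -/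
open MeasureTheory

/-- Corollary `fix-subset`: bounds when a subset of the treatments acts as a
generalized instrument for the remainder. -/
theorem fix_subset_bounds {Ω ℬ 𝒴 : Type*} [MeasurableSpace Ω]
    (μ : Measure Ω) [IsProbabilityMeasure μ]
    (Ahat0 : Ω → ℬ) (Yt : Ω → 𝒴) (Yf : ℬ → Ω → 𝒴)
    (hcons : ∀ ω : Ω, Yt ω = Yf (Ahat0 ω) ω)
    (hAm : ∀ b : ℬ, MeasurableSet {ω | Ahat0 ω = b})
    (hYtm : ∀ y : 𝒴, MeasurableSet {ω | Yt ω = y})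
    (hYfm : ∀ (b : ℬ) (y : 𝒴), MeasurableSet {ω | Yf b ω = y}) :
    ∀ (ahat : ℬ) (y : 𝒴),
      (μ {ω | Yt ω = y ∧ Ahat0 ω = ahat}).toReal
        ≤ (μ {ω | Yf ahat ω = y}).toReal ∧
      (μ {ω | Yf ahat ω = y}).toReal
        ≤ 1 - (μ {ω | Yt ω ≠ y ∧ Ahat0 ω = ahat}).toReal := by
  intro ahat y
  have h1 : {ω | Yt ω = y ∧ Ahat0 ω = ahat} ⊆ {ω | Yf ahat ω = y} := by
    rintro ω ⟨h, h2⟩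
    have h3 := hcons ω
    rw [h2] at h3
    exact h3.symm.trans h
  have h2 : {ω | Yt ω ≠ y ∧ Ahat0 ω = ahat} ⊆ {ω | Yf ahat ω = y}ᶜ := by
    rintro ω ⟨h, h2⟩ h4
    have h3 := hcons ω
    rw [h2] at h3
    exact h (h3.trans h4)
  have h3 := measureReal_mono (μ := μ) h1
  have h4 := measureReal_mono (μ := μ) h2
  rw [probReal_compl_eq_one_sub (hYfm ahat y)] at h4
  simp only [Measure.real] at h3 h4
  exact ⟨h3, by linarith⟩
end

section
/- Sequential treatment scenario bounds: Let 𝓗, 𝒩₁, 𝒩ᵧ₁, 𝒩₂, 𝒩ᵧ₂ and the value types 𝒜₁, 𝒴₁, 𝒜₂, 𝒴₂ be finite types. Let H, N1, NY1, N2, NY2 be measurable random variables on a probability space (Ω, ℱ, μ) (μ a probability measure) with values in these noise types, and suppose N2 is independent of the joint random variable (H, N1, NY1, NY2). Define A1 = f_{A1}(H, N1), Y1 = f_{Y1}(A1, H, NY1), A2 = f_{A2}(Y1, N2), Y2 = f_{Y2}(A1, A2, H, NY2) for given functions f_{A1}, f_{Y1}, f_{A2}, f_{Y2}, and define the counterfactual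 Y2(a1, a2)(ω) := f_{Y2}(a1, a2, H(ω), NY2(ω)). Fix a1 ∈ 𝒜₁, a2 ∈ 𝒜₂, y2 ∈ 𝒴₂, and assume positivity: μ(A2=a2 and Y1=y1) > 0 for every y1 ∈ 𝒴₁. Then Σ_{y1 ∈ 𝒴₁} μ(A1=a1, Y1=y1, A2=a2, Y2=y2) · μ(Y1=y1) / μ(A2=a2, Y1=y1) ≤ μ(Y2(a1,a2)=y2) ≤ 1 − Σ_{y1 ∈ 𝒴₁} Σ_{y2' ≠ y2} μ(A1=a1, Y1=y1, A2=a2, Y2=y2') · μ(Y1=y1) / μ(A2=a2, Y1=y1). -/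
open MeasureTheory ProbabilityTheory

/-- Sequential treatment scenario bounds (Figure 2). -/
theorem sequential_treatment_bounds
    {Ω 𝓗 𝒩₁ 𝒩y₁ 𝒩₂ 𝒩y₂ 𝒜₁ 𝒴₁ 𝒜₂ 𝒴₂ : Type*}
    [MeasurableSpace Ω]
    [Fintype 𝓗] [Fintype 𝒩₁] [Fintype 𝒩y₁] [Fintype 𝒩₂] [Fintype 𝒩y₂]
    [Fintype 𝒜₁] [Fintype 𝒴₁] [Fintype 𝒜₂] [Fintype 𝒴₂] [DecidableEq 𝒴₂]
    [MeasurableSpace 𝓗] [MeasurableSingletonClass 𝓗]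
    [MeasurableSpace 𝒩₁] [MeasurableSingletonClass 𝒩₁]
    [MeasurableSpace 𝒩y₁] [MeasurableSingletonClass 𝒩y₁]
    [MeasurableSpace 𝒩₂] [MeasurableSingletonClass 𝒩₂]
    [MeasurableSpace 𝒩y₂] [MeasurableSingletonClass 𝒩y₂]
    (μ : Measure Ω) [IsProbabilityMeasure μ]
    (H : Ω → 𝓗) (N1 : Ω → 𝒩₁) (NY1 : Ω → 𝒩y₁) (N2 : Ω → 𝒩₂) (NY2 : Ω → 𝒩y₂)
    (hH : Measurable H) (hN1 : Measurable N1) (hNY1 : Measurable NY1)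
    (hN2 : Measurable N2) (hNY2 : Measurable NY2)
    (hindep : IndepFun N2 (fun ω => (H ω, N1 ω, NY1 ω, NY2 ω)) μ)
    (fA1 : 𝓗 → 𝒩₁ → 𝒜₁) (fY1 : 𝒜₁ → 𝓗 → 𝒩y₁ → 𝒴₁)
    (fA2 : 𝒴₁ → 𝒩₂ → 𝒜₂) (fY2 : 𝒜₁ → 𝒜₂ → 𝓗 → 𝒩y₂ → 𝒴₂)
    (A1 : Ω → 𝒜₁) (hA1 : ∀ ω, A1 ω = fA1 (H ω) (N1 ω))
    (Y1 : Ω → 𝒴₁) (hY1 : ∀ ω, Y1 ω = fY1 (A1 ω) (H ω) (NY1 ω))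
    (A2 : Ω → 𝒜₂) (hA2 : ∀ ω, A2 ω = fA2 (Y1 ω) (N2 ω))
    (Y2 : Ω → 𝒴₂) (hY2 : ∀ ω, Y2 ω = fY2 (A1 ω) (A2 ω) (H ω) (NY2 ω))
    (Y2cf : 𝒜₁ → 𝒜₂ → Ω → 𝒴₂)
    (hY2cf : ∀ (a1 : 𝒜₁) (a2 : 𝒜₂) (ω : Ω), Y2cf a1 a2 ω = fY2 a1 a2 (H ω) (NY2 ω))
    (a1 : 𝒜₁) (a2 : 𝒜₂) (y2 : 𝒴₂)
    (hpos : ∀ y1 : 𝒴₁, 0 < μ {ω | A2 ω = a2 ∧ Y1 ω = y1}) :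
    (∑ y1 : 𝒴₁,
        (μ {ω | A1 ω = a1 ∧ Y1 ω = y1 ∧ A2 ω = a2 ∧ Y2 ω = y2}).toReal *
          (μ {ω | Y1 ω = y1}).toReal / (μ {ω | A2 ω = a2 ∧ Y1 ω = y1}).toReal
      ≤ (μ {ω | Y2cf a1 a2 ω = y2}).toReal) ∧
    ((μ {ω | Y2cf a1 a2 ω = y2}).toReal
      ≤ 1 - ∑ y1 : 𝒴₁, ∑ y2' ∈ Finset.univ.filter (· ≠ y2),
        (μ {ω | A1 ω = a1 ∧ Y1 ω = y1 ∧ A2 ω = a2 ∧ Y2 ω = y2'}).toReal *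
          (μ {ω | Y1 ω = y1}).toReal / (μ {ω | A2 ω = a2 ∧ Y1 ω = y1}).toReal) := by
  classical
  set G : Ω → 𝓗 × 𝒩₁ × 𝒩y₁ × 𝒩y₂ := fun ω => (H ω, N1 ω, NY1 ω, NY2 ω) with hG
  have hGm : Measurable G := by fun_prop
  have hm : ∀ t : Set (𝓗 × 𝒩₁ × 𝒩y₁ × 𝒩y₂), MeasurableSet (G ⁻¹' t) :=
    fun t => hGm (Set.toFinite t).measurableSet
  have hprod : ∀ (s : Set 𝒩₂) (t : Set (𝓗 × 𝒩₁ × 𝒩y₁ × 𝒩y₂)),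
      (μ (N2 ⁻¹' s ∩ G ⁻¹' t)).toReal = (μ (N2 ⁻¹' s)).toReal * (μ (G ⁻¹' t)).toReal := by
    intro s t
    rw [hindep.measure_inter_preimage_eq_mul s t (Set.toFinite s).measurableSet
      (Set.toFinite t).measurableSet, ENNReal.toReal_mul]
  have key : ∀ (y1 : 𝒴₁) (y : 𝒴₂),
      (μ {ω | A1 ω = a1 ∧ Y1 ω = y1 ∧ A2 ω = a2 ∧ Y2 ω = y}).toReal *
          (μ {ω | Y1 ω = y1}).toReal / (μ {ω | A2 ω = a2 ∧ Y1 ω = y1}).toReal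
        = (μ {ω | A1 ω = a1 ∧ Y1 ω = y1 ∧ Y2cf a1 a2 ω = y}).toReal := by
    intro y1 y
    have e1 : {ω | A1 ω = a1 ∧ Y1 ω = y1 ∧ A2 ω = a2 ∧ Y2 ω = y} =
        N2 ⁻¹' {n | fA2 y1 n = a2} ∩ G ⁻¹' {z | fA1 z.1 z.2.1 = a1 ∧
          fY1 (fA1 z.1 z.2.1) z.1 z.2.2.1 = y1 ∧ fY2 a1 a2 z.1 z.2.2.2 = y} := by
      ext ω
      simp only [Set.mem_setOf_eq, Set.mem_inter_iff, Set.mem_preimage, hG]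
      grind
    have e2 : {ω | A1 ω = a1 ∧ Y1 ω = y1 ∧ Y2cf a1 a2 ω = y} =
        G ⁻¹' {z | fA1 z.1 z.2.1 = a1 ∧
          fY1 (fA1 z.1 z.2.1) z.1 z.2.2.1 = y1 ∧ fY2 a1 a2 z.1 z.2.2.2 = y} := by
      ext ω
      simp only [Set.mem_setOf_eq, Set.mem_preimage, hG]
      grind
    have e3 : {ω | Y1 ω = y1} = G ⁻¹' {z | fY1 (fA1 z.1 z.2.1) z.1 z.2.2.1 = y1} := by
      ext ω
      simp only [Set.mem_setOf_eq, Set.mem_preimage, hG]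
      grind
    have e4 : {ω | A2 ω = a2 ∧ Y1 ω = y1} = N2 ⁻¹' {n | fA2 y1 n = a2} ∩
        G ⁻¹' {z | fY1 (fA1 z.1 z.2.1) z.1 z.2.2.1 = y1} := by
      ext ω
      simp only [Set.mem_setOf_eq, Set.mem_inter_iff, Set.mem_preimage, hG]
      grind
    have hp : (μ {ω | A2 ω = a2 ∧ Y1 ω = y1}).toReal ≠ 0 :=
      (ENNReal.toReal_pos (hpos y1).ne' (measure_ne_top _ _)).ne'
    rw [div_eq_iff hp, e1, e2, e3, e4, hprod, hprod]
    ring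
  have hcf : ∀ y : 𝒴₂, MeasurableSet {ω | Y2cf a1 a2 ω = y} := by
    intro y
    have : {ω | Y2cf a1 a2 ω = y} = G ⁻¹' {z | fY2 a1 a2 z.1 z.2.2.2 = y} := by
      ext ω
      simp only [Set.mem_setOf_eq, Set.mem_preimage, hG, hY2cf]
    rw [this]
    exact hm _
  have low : ∀ y : 𝒴₂,
      ∑ y1 : 𝒴₁, (μ {ω | A1 ω = a1 ∧ Y1 ω = y1 ∧ Y2cf a1 a2 ω = y}).toReal
        ≤ (μ {ω | Y2cf a1 a2 ω = y}).toReal := by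
    intro y
    have hms : ∀ y1 : 𝒴₁, MeasurableSet {ω | A1 ω = a1 ∧ Y1 ω = y1 ∧ Y2cf a1 a2 ω = y} := by
      intro y1
      have e2 : {ω | A1 ω = a1 ∧ Y1 ω = y1 ∧ Y2cf a1 a2 ω = y} =
        G ⁻¹' {z | fA1 z.1 z.2.1 = a1 ∧
          fY1 (fA1 z.1 z.2.1) z.1 z.2.2.1 = y1 ∧ fY2 a1 a2 z.1 z.2.2.2 = y} := by
        ext ω
        simp only [Set.mem_setOf_eq, Set.mem_preimage, hG]
        grind
      rw [e2]
      exact hm _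
    rw [← ENNReal.toReal_sum (fun _ _ => measure_ne_top _ _),
      ← measure_biUnion_finset _ (fun y1 _ => hms y1)]
    · refine ENNReal.toReal_mono (measure_ne_top _ _) (measure_mono ?_)
      refine Set.iUnion₂_subset fun y1 _ ω hω => hω.2.2
    · intro i _ j _ hij
      refine Set.disjoint_left.2 fun ω h1 h2 => hij (h1.2.1.symm.trans h2.2.1)
  have tot : ∑ y : 𝒴₂, (μ {ω | Y2cf a1 a2 ω = y}).toReal = 1 := by
    rw [← ENNReal.toReal_sum (fun _ _ => measure_ne_top _ _),
      ← measure_biUnion_finset _ (fun y _ => hcf y)]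
    · have : (⋃ y ∈ (Finset.univ : Finset 𝒴₂), {ω | Y2cf a1 a2 ω = y}) = Set.univ := by
        ext ω
        simp
      rw [this]
      simp
    · intro i _ j _ hij
      refine Set.disjoint_left.2 fun ω h1 h2 => hij (h1.symm.trans h2)
  simp only [key]
  refine ⟨low y2, ?_⟩
  rw [Finset.sum_comm]
  have h1 := Finset.sum_le_sum (s := Finset.univ.filter (· ≠ y2)) (fun y _ => low y)
  have h2 := Finset.sum_filter_add_sum_filter_not Finset.univ (· ≠ y2)
    (fun y => (μ {ω | Y2cf a1 a2 ω = y}).toReal)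
  have h3 : Finset.univ.filter (fun y => ¬ (y ≠ y2)) = {y2} := by
    ext y
    simp
  rw [h3, Finset.sum_singleton, tot] at h2
  linarith
end

section
/- Lower bound on P(Y(ā)=ȳ) in the IV model with covariates: Assume the functional IV model with binary covariate, and let a, y, c, z ∈ Bool with ā=¬a, ȳ=¬y, c̄=¬c, z̄=¬z. Then μ({Yc(ā)=ȳ}) ≥ P_{z̄}(a:ā, y:ȳ) + max of the following twelve quantities: 0; P_z(a:ā, y:ȳ, C:c) − P_{z̄}(a:ā, y:ȳ, C:c); P_{z̄}(a:a, C:c, y:ȳ) − (P_z(C:c, a:ā, y:y) + P_z(C:c, a:a, y:ȳ)); P_{z̄}(a:a, C:c̄, y:y) − P_z(C:c̄, y:y); P_z(a:ā, y:ȳ) − P_{z̄}(a:ā, y:ȳ); P_{z̄}(a:a, y:y) − P_z(y:y); P_{z̄}(a:a, y:ȳ) − (P_z(a:a, y:ȳ) + P_z(a:ā, y:y)); P_{z̄}(a:a, C:c, y:y) − P_z(C:c, y:y); P_z(a:ā, y:ȳ, C:c̄) − P_{z̄}(a:ā, y:ȳ, C:c̄); P_{z̄}(a:a, C:c) − (P_z(C:c,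 y:y) + P_z(C:c, a:a, y:ȳ)); P_{z̄}(a:a, C:c̄) − (P_z(C:c̄, a:a, y:ȳ) + P_z(C:c̄, y:y)); P_{z̄}(a:a, C:c̄, y:ȳ) − (P_z(C:c̄, a:ā, y:y) + P_z(C:c̄, a:a, y:ȳ)). Here P_{z'}(·) denotes μ of the event whose listed constraints are imposed on A(z'), Y(z') and C, e.g. P_z(C:c, a:ā, y:y) = μ({ω : C(ω)=c and A(z)(ω)=ā and Y(z)(ω)=y}) and P_z(y:y) = μ({ω : Y(z)(ω)=y}). -/
open MeasureTheory

set_option maxHeartbeats 4000000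
set_option synthInstance.maxSize 2000
set_option synthInstance.maxHeartbeats 400000

lemma iv_aux {Ω : Type*} [MeasurableSpace Ω] (μ : Measure Ω) [IsProbabilityMeasure μ]
    (E P N M T : Ω → Prop)
    (hE : MeasurableSet {ω | E ω}) (hP : MeasurableSet {ω | P ω}) (hN : MeasurableSet {ω | N ω})
    (hM : MeasurableSet {ω | M ω}) (hT : MeasurableSet {ω | T ω})
    (h1 : ∀ ω, E ω → T ω ∨ N ω ∨ M ω)
    (h2 : ∀ ω, P ω → T ω ∨ N ω ∨ M ω)
    (h3 : ∀ ω, E ω → P ω → (T ω ∧ N ω) ∨ (T ω ∧ M ω) ∨ (N ω ∧ M ω)) :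
    (μ {ω | E ω}).toReal + (μ {ω | P ω}).toReal ≤
      (μ {ω | T ω}).toReal + ((μ {ω | N ω}).toReal + (μ {ω | M ω}).toReal) := by
  classical
  have key : μ {ω | E ω} + μ {ω | P ω} ≤ μ {ω | T ω} + (μ {ω | N ω} + μ {ω | M ω}) := by
    have hm : ∀ {S : Set Ω}, MeasurableSet S → Measurable (S.indicator (1 : Ω → ENNReal)) :=
      fun hS => measurable_one.indicator hS
    rw [← lintegral_indicator_one hE, ← lintegral_indicator_one hP, ← lintegral_indicator_one hN,
      ← lintegral_indicator_one hM, ← lintegral_indicator_one hT,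
      ← lintegral_add_left (hm hE), ← lintegral_add_left (hm hN), ← lintegral_add_left (hm hT)]
    apply lintegral_mono
    intro ω
    have := h1 ω
    have := h2 ω
    have := h3 ω
    by_cases e : E ω <;> by_cases p : P ω <;> by_cases n : N ω <;> by_cases m : M ω <;>
      by_cases t : T ω <;> simp_all [Set.indicator]
  have := ENNReal.toReal_mono (by finiteness) key
  rwa [ENNReal.toReal_add (by finiteness) (by finiteness),
    ENNReal.toReal_add (by finiteness) (by finiteness),
    ENNReal.toReal_add (by finiteness) (by finiteness)] at this

lemma iv_aux1 {Ω : Type*} [MeasurableSpace Ω] (μ : Measure Ω) [IsProbabilityMeasure μ]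
    (E P N T : Ω → Prop)
    (hE : MeasurableSet {ω | E ω}) (hP : MeasurableSet {ω | P ω}) (hN : MeasurableSet {ω | N ω})
    (hT : MeasurableSet {ω | T ω})
    (h1 : ∀ ω, E ω → T ω ∨ N ω)
    (h2 : ∀ ω, P ω → T ω ∨ N ω)
    (h3 : ∀ ω, E ω → P ω → (T ω ∧ N ω)) :
    (μ {ω | E ω}).toReal + (μ {ω | P ω}).toReal ≤
      (μ {ω | T ω}).toReal + (μ {ω | N ω}).toReal := by
  have := iv_aux μ E P N (fun _ => False) T hE hP hN (by simp) hT (by grind) (by grind) (by grind)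
  simpa using this

/-- Lower bound on P(Y(ā)=ȳ) in the IV model with covariates (Figure 3(a)). -/
theorem iv_with_covariates_lower_bound {Ω : Type*} [MeasurableSpace Ω]
    (μ : Measure Ω) [IsProbabilityMeasure μ]
    (C : Ω → Bool) (A : Bool → Ω → Bool) (Yc : Bool → Ω → Bool)
    (Y : Bool → Ω → Bool)
    (hY : ∀ (z : Bool) (ω : Ω), Y z ω = Yc (A z ω) ω)
    (hCm : Measurable C)
    (hAm : ∀ z : Bool, Measurable (A z))
    (hYcm : ∀ a : Bool, Measurable (Yc a))
    (hYm : ∀ z : Bool, Measurable (Y z))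
    (a y c z : Bool) :
    (μ {ω | A (!z) ω = !a ∧ Y (!z) ω = !y}).toReal +
      max 0 (max
        ((μ {ω | A z ω = !a ∧ Y z ω = !y ∧ C ω = c}).toReal -
          (μ {ω | A (!z) ω = !a ∧ Y (!z) ω = !y ∧ C ω = c}).toReal) (max
        ((μ {ω | A (!z) ω = a ∧ C ω = c ∧ Y (!z) ω = !y}).toReal -
          ((μ {ω | C ω = c ∧ A z ω = !a ∧ Y z ω = y}).toReal +
           (μ {ω | C ω = c ∧ A z ω = a ∧ Y z ω = !y}).toReal)) (max
        ((μ {ω | A (!z) ω = a ∧ C ω = !c ∧ Y (!z) ω = y}).toReal -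
          (μ {ω | C ω = !c ∧ Y z ω = y}).toReal) (max
        ((μ {ω | A z ω = !a ∧ Y z ω = !y}).toReal -
          (μ {ω | A (!z) ω = !a ∧ Y (!z) ω = !y}).toReal) (max
        ((μ {ω | A (!z) ω = a ∧ Y (!z) ω = y}).toReal -
          (μ {ω | Y z ω = y}).toReal) (max
        ((μ {ω | A (!z) ω = a ∧ Y (!z) ω = !y}).toReal -
          ((μ {ω | A z ω = a ∧ Y z ω = !y}).toReal +
           (μ {ω | A z ω = !a ∧ Y z ω = y}).toReal)) (max
        ((μ {ω | A (!z) ω = a ∧ C ω = c ∧ Y (!z) ω = y}).toReal -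
          (μ {ω | C ω = c ∧ Y z ω = y}).toReal) (max
        ((μ {ω | A z ω = !a ∧ Y z ω = !y ∧ C ω = !c}).toReal -
          (μ {ω | A (!z) ω = !a ∧ Y (!z) ω = !y ∧ C ω = !c}).toReal) (max
        ((μ {ω | A (!z) ω = a ∧ C ω = c}).toReal -
          ((μ {ω | C ω = c ∧ Y z ω = y}).toReal +
           (μ {ω | C ω = c ∧ A z ω = a ∧ Y z ω = !y}).toReal)) (max
        ((μ {ω | A (!z) ω = a ∧ C ω = !c}).toReal -
          ((μ {ω | C ω = !c ∧ A z ω = a ∧ Y z ω = !y}).toReal +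
           (μ {ω | C ω = !c ∧ Y z ω = y}).toReal))
        ((μ {ω | A (!z) ω = a ∧ C ω = !c ∧ Y (!z) ω = !y}).toReal -
          ((μ {ω | C ω = !c ∧ A z ω = !a ∧ Y z ω = y}).toReal +
           (μ {ω | C ω = !c ∧ A z ω = a ∧ Y z ω = !y}).toReal))))))))))))
      ≤ (μ {ω | Yc (!a) ω = !y}).toReal := by
  have ms : ∀ (f : Ω → Bool) (b : Bool), Measurable f → MeasurableSet {ω | f ω = b} :=
    fun f b hf => hf (measurableSet_singleton b)
  have e1 := fun b => ms C b hCm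
  have e2 := fun z b => ms (A z) b (hAm z)
  have e3 := fun z b => ms (Yc z) b (hYcm z)
  have e4 := fun z b => ms (Y z) b (hYm z)
  have an : ∀ (p q : Ω → Prop), MeasurableSet {ω | p ω} → MeasurableSet {ω | q ω} →
      MeasurableSet {ω | p ω ∧ q ω} := fun p q hp hq => hp.inter hq
  rw [← le_sub_iff_add_le']
  simp only [max_le_iff]
  refine ⟨?_, ?_, ?_, ?_, ?_, ?_, ?_, ?_, ?_, ?_, ?_, ?_⟩
  · rw [sub_nonneg]
    refine ENNReal.toReal_mono (by finiteness) (measure_mono ?_)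
    intro ω h
    have := hY (!z) ω
    simp only [Set.mem_ofPred_eq] at *
    grind
  all_goals
    rw [le_sub_iff_add_le', ← add_sub_assoc, sub_le_iff_le_add]
    first
      | apply iv_aux
      | apply iv_aux1
  all_goals first
    | exact e1 _
    | exact e2 _ _
    | exact e3 _ _
    | exact e4 _ _
    | exact an _ _ (e2 _ _) (e4 _ _)
    | exact an _ _ (e2 _ _) (e1 _)
    | exact an _ _ (e1 _) (e4 _ _)
    | exact an _ _ (e2 _ _) (an _ _ (e4 _ _) (e1 _))
    | exact an _ _ (e2 _ _) (an _ _ (e1 _) (e4 _ _))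
    | exact an _ _ (e1 _) (an _ _ (e2 _ _) (e4 _ _))
    | skip
  all_goals
    intro ω
    have h1 := hY (!z) ω
    have h2 := hY z ω
    clear e1 e2 e3 e4 an ms hY hCm hAm hYcm hYm
    revert h1 h2
    generalize A (!z) ω = u
    generalize A z ω = v
    generalize Y (!z) ω = s
    generalize Y z ω = t
    generalize C ω = d
    generalize hp : Yc true ω = p
    generalize hq : Yc false ω = q
    cases a <;> simp only [Bool.not_true, Bool.not_false, hp, hq] <;>
      cases u <;> cases v <;> simp only [hp, hq] <;> clear hp hq <;>
      revert s t d c y p q <;> decide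
end

section
/- Lower bound on P(Y(ā)=ȳ) in the confounded front-door IV model: Assume the functional front-door IV model, and let a, m, y, z ∈ Bool with ā=¬a, m̄=¬m, ȳ=¬y, z̄=¬z. Then μ({Y(ā)=ȳ}) ≥ P_{z̄}(a:ā, y:ȳ) + max of the following twelve quantities: 0; P_z(a:ā, y:ȳ, m:m̄) − P_{z̄}(a:ā, m:m̄, y:ȳ); P_z(a:ā, y:ȳ) − P_{z̄}(a:ā, y:ȳ); P_{z̄}(a:a, m:m̄, y:y) − (P_z(m:m̄, y:y) + P_z(a:ā, m:m, y:y)); P_{z̄}(a:a, m:m, y:y) − (P_z(m:m, y:y) + P_z(a:ā, m:m̄, y:y)); P_{z̄}(a:a, y:ȳ) − (P_z(a:a, y:ȳ) + P_z(a:ā, y:y)); P_{z̄}(a:a, m:m) − (P_z(a:a, m:m, y:ȳ) + P_z(m:m, y:y) + P_z(a:ā, m:m̄, y:y)); P_z(a:ā, y:ȳ, m:m) − P_{z̄}(a:ā, m:m, y:ȳ); P_{z̄}(a:a, m:m, y:ȳ) − (P_z(a:ā, m:m̄, y:y) + P_z(a:a, m:m, y:ȳ)); P_{z̄}(a:a,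 m:m̄, y:ȳ) − (P_z(a:ā, m:m, y:y) + P_z(a:a, m:m̄, y:ȳ)); P_{z̄}(a:a, y:y) − P_z(y:y); P_{z̄}(a:a, m:m̄) − (P_z(m:m̄, y:y) + P_z(a:ā, m:m, y:y) + P_z(a:a, m:m̄, y:ȳ)). Here P_{z'}(·) denotes μ of the event whose listed constraints are imposed on A(z'), M(z') and Y(z'), e.g. P_z(m:m̄, y:y) = μ({ω : M(z)(ω)=m̄ and Y(z)(ω)=y}). -/
open MeasureTheory

lemma fd_aux {Ω : Type*} [MeasurableSpace Ω] (μ : Measure Ω) [IsProbabilityMeasure μ]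
    (S T R N : Set Ω) (hT : MeasurableSet T) (hN : MeasurableSet N)
    (h1 : ∀ ω, ω ∈ S ∨ ω ∈ T → ω ∈ R ∨ ω ∈ N)
    (h2 : ∀ ω, ω ∈ S → ω ∈ T → ω ∈ R ∧ ω ∈ N) :
    (μ S).toReal + (μ T).toReal ≤ (μ R).toReal + (μ N).toReal := by
  have e1 := measureReal_union_add_inter (μ := μ) (s := S) hT
  have e2 := measureReal_union_add_inter (μ := μ) (s := R) hN
  have i1 : μ.real (S ∪ T) ≤ μ.real (R ∪ N) := measureReal_mono (fun ω h => h1 ω h)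
  have i2 : μ.real (S ∩ T) ≤ μ.real (R ∩ N) := measureReal_mono (fun ω h => h2 ω h.1 h.2)
  simp only [Measure.real] at *
  linarith

lemma fd_one {Ω : Type*} [MeasurableSpace Ω] (μ : Measure Ω) [IsProbabilityMeasure μ]
    (S T R N : Set Ω) (hT : MeasurableSet T) (hN : MeasurableSet N)
    (h : ∀ ω, (ω ∈ S ∨ ω ∈ T → ω ∈ R ∨ ω ∈ N) ∧ (ω ∈ S → ω ∈ T → ω ∈ R ∧ ω ∈ N)) :
    (μ T).toReal - (μ N).toReal ≤ (μ R).toReal - (μ S).toReal := by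
  have := fd_aux μ S T R N hT hN (fun ω => (h ω).1) (fun ω => (h ω).2)
  linarith

lemma fd_two {Ω : Type*} [MeasurableSpace Ω] (μ : Measure Ω) [IsProbabilityMeasure μ]
    (S T R N N' : Set Ω) (hT : MeasurableSet T) (hN : MeasurableSet N) (hN' : MeasurableSet N')
    (h : ∀ ω, (ω ∈ S ∨ ω ∈ T → ω ∈ R ∨ ω ∈ N ∪ N') ∧ (ω ∈ S → ω ∈ T → ω ∈ R ∧ ω ∈ N ∪ N')) :
    (μ T).toReal - ((μ N).toReal + (μ N').toReal) ≤ (μ R).toReal - (μ S).toReal := by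
  have h1 := fd_one μ S T R _ hT (hN.union hN') h
  have h2 : (μ (N ∪ N')).toReal ≤ (μ N).toReal + (μ N').toReal := measureReal_union_le N N'
  linarith

lemma fd_three {Ω : Type*} [MeasurableSpace Ω] (μ : Measure Ω) [IsProbabilityMeasure μ]
    (S T R N N' K : Set Ω) (hT : MeasurableSet T) (hN : MeasurableSet N) (hN' : MeasurableSet N')
    (hK : MeasurableSet K) (h : ∀ ω, (ω ∈ S ∨ ω ∈ T → ω ∈ R ∨ ω ∈ N ∪ N' ∪ K) ∧
      (ω ∈ S → ω ∈ T → ω ∈ R ∧ ω ∈ N ∪ N' ∪ K)) :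
    (μ T).toReal - ((μ N).toReal + (μ N').toReal + (μ K).toReal) ≤
      (μ R).toReal - (μ S).toReal := by
  have h1 := fd_two μ S T R _ K hT (hN.union hN') hK h
  have h2 : (μ (N ∪ N')).toReal ≤ (μ N).toReal + (μ N').toReal := measureReal_union_le N N'
  linarith

set_option maxHeartbeats 4000000 in
set_option linter.unusedSimpArgs false in
/-- Lower bound on P(Y(ā)=ȳ) in the confounded front-door IV model (Figure 3(b)). -/
theorem frontdoor_iv_lower_bound {Ω : Type*} [MeasurableSpace Ω]
    (μ : Measure Ω) [IsProbabilityMeasure μ]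
    (A : Bool → Ω → Bool) (Mc : Bool → Ω → Bool) (Ymc : Bool → Ω → Bool)
    (M : Bool → Ω → Bool) (hM : ∀ (z : Bool) (ω : Ω), M z ω = Mc (A z ω) ω)
    (Ya : Bool → Ω → Bool) (hYa : ∀ (a : Bool) (ω : Ω), Ya a ω = Ymc (Mc a ω) ω)
    (Yz : Bool → Ω → Bool) (hYz : ∀ (z : Bool) (ω : Ω), Yz z ω = Ymc (M z ω) ω)
    (hAm : ∀ z : Bool, Measurable (A z))
    (hMcm : ∀ a : Bool, Measurable (Mc a))
    (hYmcm : ∀ m : Bool, Measurable (Ymc m))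
    (hMm : ∀ z : Bool, Measurable (M z))
    (hYam : ∀ a : Bool, Measurable (Ya a))
    (hYzm : ∀ z : Bool, Measurable (Yz z))
    (a m y z : Bool) :
    (μ {ω | A (!z) ω = !a ∧ Yz (!z) ω = !y}).toReal +
      max 0 (max
        ((μ {ω | A z ω = !a ∧ Yz z ω = !y ∧ M z ω = !m}).toReal -
          (μ {ω | A (!z) ω = !a ∧ M (!z) ω = !m ∧ Yz (!z) ω = !y}).toReal) (max
        ((μ {ω | A z ω = !a ∧ Yz z ω = !y}).toReal -
          (μ {ω | A (!z) ω = !a ∧ Yz (!z) ω = !y}).toReal) (max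
        ((μ {ω | A (!z) ω = a ∧ M (!z) ω = !m ∧ Yz (!z) ω = y}).toReal -
          ((μ {ω | M z ω = !m ∧ Yz z ω = y}).toReal +
           (μ {ω | A z ω = !a ∧ M z ω = m ∧ Yz z ω = y}).toReal)) (max
        ((μ {ω | A (!z) ω = a ∧ M (!z) ω = m ∧ Yz (!z) ω = y}).toReal -
          ((μ {ω | M z ω = m ∧ Yz z ω = y}).toReal +
           (μ {ω | A z ω = !a ∧ M z ω = !m ∧ Yz z ω = y}).toReal)) (max
        ((μ {ω | A (!z) ω = a ∧ Yz (!z) ω = !y}).toReal -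
          ((μ {ω | A z ω = a ∧ Yz z ω = !y}).toReal +
           (μ {ω | A z ω = !a ∧ Yz z ω = y}).toReal)) (max
        ((μ {ω | A (!z) ω = a ∧ M (!z) ω = m}).toReal -
          ((μ {ω | A z ω = a ∧ M z ω = m ∧ Yz z ω = !y}).toReal +
           (μ {ω | M z ω = m ∧ Yz z ω = y}).toReal +
           (μ {ω | A z ω = !a ∧ M z ω = !m ∧ Yz z ω = y}).toReal)) (max
        ((μ {ω | A z ω = !a ∧ Yz z ω = !y ∧ M z ω = m}).toReal -
          (μ {ω | A (!z) ω = !a ∧ M (!z) ω = m ∧ Yz (!z) ω = !y}).toReal) (max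
        ((μ {ω | A (!z) ω = a ∧ M (!z) ω = m ∧ Yz (!z) ω = !y}).toReal -
          ((μ {ω | A z ω = !a ∧ M z ω = !m ∧ Yz z ω = y}).toReal +
           (μ {ω | A z ω = a ∧ M z ω = m ∧ Yz z ω = !y}).toReal)) (max
        ((μ {ω | A (!z) ω = a ∧ M (!z) ω = !m ∧ Yz (!z) ω = !y}).toReal -
          ((μ {ω | A z ω = !a ∧ M z ω = m ∧ Yz z ω = y}).toReal +
           (μ {ω | A z ω = a ∧ M z ω = !m ∧ Yz z ω = !y}).toReal)) (max
        ((μ {ω | A (!z) ω = a ∧ Yz (!z) ω = y}).toReal -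
          (μ {ω | Yz z ω = y}).toReal)
        ((μ {ω | A (!z) ω = a ∧ M (!z) ω = !m}).toReal -
          ((μ {ω | M z ω = !m ∧ Yz z ω = y}).toReal +
           (μ {ω | A z ω = !a ∧ M z ω = m ∧ Yz z ω = y}).toReal +
           (μ {ω | A z ω = a ∧ M z ω = !m ∧ Yz z ω = !y}).toReal))))))))))))
      ≤ (μ {ω | Ya (!a) ω = !y}).toReal := by
  have ms : ∀ (f : Ω → Bool) (b : Bool), Measurable f → MeasurableSet {ω | f ω = b} :=
    fun f b hf => hf (measurableSet_singleton b)
  have mA : ∀ z b, MeasurableSet {ω | A z ω = b} := fun z b => ms _ b (hAm z)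
  have mM : ∀ z b, MeasurableSet {ω | M z ω = b} := fun z b => ms _ b (hMm z)
  have mY : ∀ z b, MeasurableSet {ω | Yz z ω = b} := fun z b => ms _ b (hYzm z)
  have mAY : ∀ z b d, MeasurableSet {ω | A z ω = b ∧ Yz z ω = d} :=
    fun z b d => (mA z b).inter (mY z d)
  have mAM : ∀ z b d, MeasurableSet {ω | A z ω = b ∧ M z ω = d} :=
    fun z b d => (mA z b).inter (mM z d)
  have mMY : ∀ z b d, MeasurableSet {ω | M z ω = b ∧ Yz z ω = d} :=
    fun z b d => (mM z b).inter (mY z d)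
  have mAMY : ∀ z b c d, MeasurableSet {ω | A z ω = b ∧ M z ω = c ∧ Yz z ω = d} :=
    fun z b c d => (mA z b).inter ((mM z c).inter (mY z d))
  have mAYM : ∀ z b c d, MeasurableSet {ω | A z ω = b ∧ Yz z ω = c ∧ M z ω = d} :=
    fun z b c d => (mA z b).inter ((mY z c).inter (mM z d))
  rw [← le_sub_iff_add_le']
  simp only [max_le_iff]
  refine ⟨?_, fd_one _ _ _ _ _ ?_ ?_ ?_, fd_one _ _ _ _ _ ?_ ?_ ?_, fd_two _ _ _ _ _ _ ?_ ?_ ?_ ?_,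
    fd_two _ _ _ _ _ _ ?_ ?_ ?_ ?_, fd_two _ _ _ _ _ _ ?_ ?_ ?_ ?_,
    fd_three _ _ _ _ _ _ _ ?_ ?_ ?_ ?_ ?_, fd_one _ _ _ _ _ ?_ ?_ ?_,
    fd_two _ _ _ _ _ _ ?_ ?_ ?_ ?_, fd_two _ _ _ _ _ _ ?_ ?_ ?_ ?_, fd_one _ _ _ _ _ ?_ ?_ ?_,
    fd_three _ _ _ _ _ _ _ ?_ ?_ ?_ ?_ ?_⟩
  · have := fd_one μ {ω | A (!z) ω = !a ∧ Yz (!z) ω = !y} ∅ {ω | Ya (!a) ω = !y} ∅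
      MeasurableSet.empty MeasurableSet.empty (fun ω => by
        simp only [Set.mem_ofPred_eq, Set.mem_empty_iff_false, hYz, hYa, hM]
        grind)
    simpa using this
  all_goals first
    | exact mAY _ _ _
    | exact mAM _ _ _
    | exact mMY _ _ _
    | exact mAMY _ _ _ _
    | exact mAYM _ _ _ _
    | exact mY _ _
    | skip
  all_goals
    intro ω
    simp only [Set.mem_union, Set.mem_ofPred_eq, hYz, hYa, hM]
    generalize A z ω = p
    generalize A (!z) ω = q
    have e : ∃ f g : Bool → Bool, (∀ b, Mc b ω = f b) ∧ ∀ b, Ymc b ω = g b :=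
      ⟨fun b => Mc b ω, fun b => Ymc b ω, fun _ => rfl, fun _ => rfl⟩
    obtain ⟨f, g, hf, hg⟩ := e
    simp only [hf, hg]
    clear * - a m y p q f g
    cases a <;> cases p <;> cases q <;>
      simp only [Bool.not_true, Bool.not_false, reduceCtorEq, true_and, false_and, false_or,
        or_false, and_false, false_imp_iff, imp_false, imp_true_iff, and_true, true_imp_iff] <;>
      cases f true <;> cases f false <;> cases g true <;> cases g false <;> cases m <;> cases y <;>
      decide
end

section
/- First inequality constraint for the confounded front-door IV model: Assume the functional front-door IV model, and let a, m, y, z ∈ Bool with ā=¬a, m̄=¬m, ȳ=¬y, z̄=¬z. Then μ({A(z̄)=ā, M(z̄)=m̄, Y(z̄)=y}) + μ({A(z̄)=a, M(z̄)=m, Y(z̄)=y}) + μ({A(z)=ā, M(z)=m, Y(z)=ȳ}) + μ({A(z)=a, M(z)=m̄, Y(z)=ȳ}) ≤ 1. -/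
open MeasureTheory

/-- First inequality constraint for the confounded front-door IV model. -/
theorem frontdoor_iv_inequality_one {Ω : Type*} [MeasurableSpace Ω]
    (μ : Measure Ω) [IsProbabilityMeasure μ]
    (A : Bool → Ω → Bool) (Mc : Bool → Ω → Bool) (Ymc : Bool → Ω → Bool)
    (M : Bool → Ω → Bool) (hM : ∀ (z : Bool) (ω : Ω), M z ω = Mc (A z ω) ω)
    (Yz : Bool → Ω → Bool) (hYz : ∀ (z : Bool) (ω : Ω), Yz z ω = Ymc (M z ω) ω)
    (hAm : ∀ z : Bool, Measurable (A z))
    (hMcm : ∀ a : Bool, Measurable (Mc a))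
    (hYmcm : ∀ m : Bool, Measurable (Ymc m))
    (hMm : ∀ z : Bool, Measurable (M z))
    (hYzm : ∀ z : Bool, Measurable (Yz z))
    (a m y z : Bool) :
    (μ {ω | A (!z) ω = !a ∧ M (!z) ω = !m ∧ Yz (!z) ω = y}).toReal +
    (μ {ω | A (!z) ω = a ∧ M (!z) ω = m ∧ Yz (!z) ω = y}).toReal +
    (μ {ω | A z ω = !a ∧ M z ω = m ∧ Yz z ω = !y}).toReal +
    (μ {ω | A z ω = a ∧ M z ω = !m ∧ Yz z ω = !y}).toReal ≤ 1 := by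
  have key : ∀ (z a m y : Bool), MeasurableSet {ω | A z ω = a ∧ M z ω = m ∧ Yz z ω = y} := by
    intro z a m y
    exact (hAm z (measurableSet_singleton a)).inter
      ((hMm z (measurableSet_singleton m)).inter (hYzm z (measurableSet_singleton y)))
  change μ.real _ + μ.real _ + μ.real _ + μ.real _ ≤ 1
  rw [← measureReal_union _ (key _ _ _ _), ← measureReal_union _ (key _ _ _ _),
    ← measureReal_union _ (key _ _ _ _)]
  · exact measureReal_le_one
  all_goals
    rw [Set.disjoint_left]
    intro ω h1 h2
    simp only [Set.mem_union, Set.mem_setOf_eq] at h1 h2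
    have e1 := hM z ω
    have e2 := hM (!z) ω
    have e3 := hYz z ω
    have e4 := hYz (!z) ω
    grind
end

section
/- Second inequality constraint for the confounded front-door IV model: Assume the functional front-door IV model, and let a, m, y, z ∈ Bool with m̄=¬m, z̄=¬z. Then Σ_{a' ∈ Bool} μ({A(z̄)=a', M(z̄)=m̄, Y(z̄)=¬y}) + Σ_{y' ∈ Bool} μ({A(z̄)=a, M(z̄)=m, Y(z̄)=y'}) + μ({A(z)=a, M(z)=m̄, Y(z)=y}) ≤ 1. -/
open MeasureTheory

/-- Second inequality constraint for the confounded front-door IV model. -/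
theorem frontdoor_iv_inequality_two {Ω : Type*} [MeasurableSpace Ω]
    (μ : Measure Ω) [IsProbabilityMeasure μ]
    (A : Bool → Ω → Bool) (Mc : Bool → Ω → Bool) (Ymc : Bool → Ω → Bool)
    (M : Bool → Ω → Bool) (hM : ∀ (z : Bool) (ω : Ω), M z ω = Mc (A z ω) ω)
    (Yz : Bool → Ω → Bool) (hYz : ∀ (z : Bool) (ω : Ω), Yz z ω = Ymc (M z ω) ω)
    (hAm : ∀ z : Bool, Measurable (A z))
    (hMcm : ∀ a : Bool, Measurable (Mc a))
    (hYmcm : ∀ m : Bool, Measurable (Ymc m))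
    (hMm : ∀ z : Bool, Measurable (M z))
    (hYzm : ∀ z : Bool, Measurable (Yz z))
    (a m y z : Bool) :
    (∑ a' : Bool, (μ {ω | A (!z) ω = a' ∧ M (!z) ω = !m ∧ Yz (!z) ω = !y}).toReal) +
    (∑ y' : Bool, (μ {ω | A (!z) ω = a ∧ M (!z) ω = m ∧ Yz (!z) ω = y'}).toReal) +
    (μ {ω | A z ω = a ∧ M z ω = !m ∧ Yz z ω = y}).toReal ≤ 1 := by
  have hS : ∀ (w b c d : Bool), MeasurableSet {ω | A w ω = b ∧ M w ω = c ∧ Yz w ω = d} := by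
    intro w b c d
    exact (hAm w (measurableSet_singleton b)).inter
      ((hMm w (measurableSet_singleton c)).inter (hYzm w (measurableSet_singleton d)))
  have key : ∀ S T : Set Ω, MeasurableSet T → (∀ ω, ω ∈ S → ω ∈ T → False) →
      (μ S).toReal + (μ T).toReal = (μ (S ∪ T)).toReal := by
    intro S T hT h
    rw [measure_union (Set.disjoint_left.mpr fun ω h1 h2 => h ω h1 h2) hT,
      ENNReal.toReal_add (measure_ne_top _ _) (measure_ne_top _ _)]
  simp only [Fintype.sum_bool]
  rw [key _ _ (hS _ _ _ _), key _ _ (hS _ _ _ _),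
    key _ _ ((hS _ _ _ _).union (hS _ _ _ _)), key _ _ (hS _ _ _ _)]
  · exact ENNReal.toReal_le_of_le_ofReal zero_le_one (by simpa using prob_le_one)
  · rintro ω ((⟨h1, h2, h3⟩ | ⟨h1, h2, h3⟩) | (⟨h1, h2, h3⟩ | ⟨h1, h2, h3⟩)) ⟨k1, k2, k3⟩
    · rw [hYz, h2] at h3
      rw [hYz, k2] at k3
      exact absurd (h3.symm.trans k3) (by simp)
    · rw [hYz, h2] at h3
      rw [hYz, k2] at k3
      exact absurd (h3.symm.trans k3) (by simp)
    · rw [hM, h1] at h2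
      rw [hM, k1] at k2
      exact absurd (h2.symm.trans k2) (by simp)
    · rw [hM, h1] at h2
      rw [hM, k1] at k2
      exact absurd (h2.symm.trans k2) (by simp)
  · rintro ω (⟨h1, h2, h3⟩ | ⟨h1, h2, h3⟩) (⟨k1, k2, k3⟩ | ⟨k1, k2, k3⟩) <;>
      exact absurd (h2.symm.trans k2) (by simp)
  · rintro ω ⟨h1, h2, h3⟩ ⟨k1, k2, k3⟩
    exact absurd (h3.symm.trans k3) (by simp)
  · rintro ω ⟨h1, h2, h3⟩ ⟨k1, k2, k3⟩
    exact absurd (h1.symm.trans k1) (by simp)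
end
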